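/- arXiv:1806.04337 — 9 statements merged into one kernel-verified Lean document; each statement's English description precedes it below -/
import Mathlib

section
/- Let X be a set and let B be a bornology on X. Then there exists a uniformity M on X such that B equals the family of all subsets of X that are totally bounded with respect to M, if and only if B is antitall. (Theorem 2, equivalence (i)⇔(iii).) -/
def IsBornology {X : Type*} (B : Set (Set X)) : Prop :=
  (∀ A ∈ B, ∀ A' ⊆ A, A' ∈ B) ∧ (∀ A ∈ B, ∀ A' ∈ B, A ∪ A' ∈ B) ∧ ∀ x : X, {x} ∈ B

def Antitall {X : Type*} (B : Set (Set X)) : Prop :=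
  ∀ Y : Set X, Y ∉ B → ∃ Z ⊆ Y, Z.Infinite ∧ ∀ Z' ⊆ Z, Z'.Infinite → Z' ∉ B

def Tall {X : Type*} (B : Set (Set X)) : Prop :=
  ∀ Y : Set X, Y.Infinite → ∃ Z ⊆ Y, Z.Infinite ∧ Z ∈ B

open scoped Uniformity

/-- A set that is not totally bounded contains an infinite set none of whose infinite subsets is
totally bounded. -/
theorem exists_infinite_subset_forall_not_totallyBounded {X : Type*} [UniformSpace X] {Y : Set X}
    (hY : ¬ TotallyBounded Y) :
    ∃ Z ⊆ Y, Z.Infinite ∧ ∀ Z' ⊆ Z, Z'.Infinite → ¬ TotallyBounded Z' := by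
  simp only [TotallyBounded, not_forall, not_exists,
    not_and] at hY
  obtain ⟨U, hU, hcover⟩ := hY
  obtain ⟨f, hfY, hf⟩ := exists_seq_of_forall_finset_exists (fun x => x ∈ Y)
    (fun x y => (y, x) ∉ U) fun s _ => by
      obtain ⟨y, hy, hys⟩ := Set.not_subset.1 (hcover s s.finite_toSet)
      exact ⟨y, hy, fun x hx hxy => hys (Set.mem_biUnion hx hxy)⟩
  have hinj : Function.Injective f := .of_lt_imp_ne fun m n hmn h =>
    hf m n hmn (h ▸ refl_mem_uniformity hU)
  refine ⟨Set.range f, Set.range_subset_iff.2 hfY, Set.infinite_range_of_injective hinj,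
    fun Z' hZ' hinf htb => ?_⟩
  obtain ⟨t, htZ, htfin, hZt⟩ := htb.exists_subset hU
  obtain ⟨N, hN⟩ := (htfin.preimage hinj.injOn).bddAbove
  have hpre : (f ⁻¹' Z').Infinite := hinf.preimage hZ'
  obtain ⟨n, hn, hNn⟩ := hpre.exists_gt N
  obtain ⟨y, hy, hny⟩ := Set.mem_iUnion₂.1 (hZt hn)
  obtain ⟨m, rfl⟩ := hZ' (htZ hy)
  exact hf m n ((hN hy).trans_lt hNn) hny

/-- A totally bounded set in a discrete uniform space is finite. -/
theorem TotallyBounded.finite_of_bot {X : Type*} {s : Set X}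
    (hs : @TotallyBounded X ⊥ s) : s.Finite := by
  let : UniformSpace X := ⊥
  obtain ⟨t, -, ht, hst⟩ := hs.exists_subset (U := SetRel.id) (Filter.mem_principal_self _)
  refine ht.subset fun x hx => ?_
  obtain ⟨y, hy, rfl⟩ := Set.mem_iUnion₂.1 (hst hx)
  exact hy

/-- Total boundedness for an infimum of uniformities. -/
theorem totallyBounded_iInf {X : Type*} {ι : Sort*} {u : ι → UniformSpace X} {s : Set X} :
    @TotallyBounded X (⨅ i, u i) s ↔ ∀ i, @TotallyBounded X (u i) s := by
  simp only [@totallyBounded_iff_ultrafilter X, cauchy_iInf_uniformSpace']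
  exact ⟨fun h i f hf => h f hf i, fun h f hf i => h i f hf⟩

/-- Total boundedness for the uniformity induced by a map. -/
theorem totallyBounded_comap {X Y : Type*} {u : UniformSpace Y} {f : X → Y} {s : Set X} :
    @TotallyBounded X (u.comap f) s ↔ TotallyBounded (f '' s) := by
  let := u.comap f
  exact (totallyBounded_image_iff ⟨rfl⟩).symm

open Classical in
/-- The map that keeps the points of `Z` apart and collapses the complement of `Z`. -/
noncomputable def collapseCompl {X : Type*} (Z : Set X) (x : X) : Option X :=
  if x ∈ Z then some x else none

theorem finite_image_collapseCompl {X : Type*} {Z s : Set X} :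
    (collapseCompl Z '' s).Finite ↔ (s ∩ Z).Finite := by
  constructor
  · intro h
    refine Set.Finite.of_finite_image (f := some)
      (h.subset ?_) (Option.some_injective X).injOn
    rintro _ ⟨x, ⟨hxs, hxZ⟩, rfl⟩
    exact ⟨x, hxs, if_pos hxZ⟩
  · intro h
    refine ((h.image some).insert none).subset ?_
    rintro _ ⟨x, hx, rfl⟩
    by_cases hxZ : x ∈ Z
    · exact Or.inr ⟨x, ⟨hx, hxZ⟩, (if_pos hxZ).symm⟩
    · exact Or.inl (if_neg hxZ)

theorem totallyBounded_comap_collapseCompl {X : Type*} {Z s : Set X} :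
    @TotallyBounded X ((⊥ : UniformSpace (Option X)).comap (collapseCompl Z)) s ↔
      (s ∩ Z).Finite := by
  rw [totallyBounded_comap, ← finite_image_collapseCompl]
  exact ⟨TotallyBounded.finite_of_bot, fun h => @Set.Finite.totallyBounded _ ⊥ _ h⟩

theorem stmt_2 {X : Type*} (B : Set (Set X)) (hB : IsBornology B) :
    (∃ M : UniformSpace X, B = {A : Set X | @TotallyBounded X M A}) ↔ Antitall B := by
  constructor
  · rintro ⟨M, rfl⟩ Y hY
    exact exists_infinite_subset_forall_not_totallyBounded hY
  · intro h
    refine ⟨⨅ Z : {Z : Set X // ∀ Z' ⊆ Z, Z'.Infinite → Z' ∉ B},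
      (⊥ : UniformSpace (Option X)).comap (collapseCompl Z.1), ?_⟩
    ext A
    simp only [Set.mem_ofPred_eq, totallyBounded_iInf, totallyBounded_comap_collapseCompl]
    constructor
    · rintro hA ⟨Z, hZ⟩
      by_contra hinf
      exact hZ _ Set.inter_subset_right hinf (hB.1 A hA _ Set.inter_subset_left)
    · intro hfin
      by_contra hA
      obtain ⟨Z, hZA, hZinf, hZ⟩ := h A hA
      exact hZinf ((hfin ⟨Z, hZ⟩).subset fun x hx => ⟨hZA hx, hx⟩)
end

section
/- Let X be a set and let B be a bornology on X. Then B is approximated by the set of all bornologies of the form B_d, where d ranges over metrics on X, if and only if B is antitall. (Theorem 3.) -/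
/-- The bornology of all closed discrete subsets of the metric space (X, d). -/
def BClosedDiscrete {X : Type*} (d : MetricSpace X) : Set (Set X) :=
  letI := d
  {A : Set X | IsClosed A ∧ DiscreteTopology A}

open Filter Topology in
theorem mem_bClosedDiscrete_iff {X : Type*} (d : MetricSpace X) (A : Set X) :
    A ∈ BClosedDiscrete d ↔ ∀ x, ∀ᶠ y in 𝓝 x, y ≠ x → y ∉ A := by
  have h : A ∈ BClosedDiscrete d ↔ IsClosed A ∧ IsDiscrete A :=
    and_congr_right fun _ => isDiscrete_iff_discreteTopology.symm
  rw [h, isClosed_and_discrete_iff]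
  simp only [disjoint_principal_right, mem_nhdsWithin_iff_eventually]
  rfl

open Set Filter Topology in
/-- A set of a metric space that is not closed and discrete contains an infinite set none of whose
infinite subsets is closed and discrete. -/
theorem exists_infinite_subset_of_notMem_bClosedDiscrete {X : Type*} (d : MetricSpace X)
    {Y : Set X} (hY : Y ∉ BClosedDiscrete d) :
    ∃ Z ⊆ Y, Z.Infinite ∧ ∀ Z' ⊆ Z, Z'.Infinite → Z' ∉ BClosedDiscrete d := by
  let := d
  simp only [mem_bClosedDiscrete_iff, not_forall] at hY
  obtain ⟨x, hx⟩ := hY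
  have hfreq : ∃ᶠ y in 𝓝 x, y ∈ Y ∧ y ≠ x := fun h =>
    hx (h.mono fun y hy hyx hyY => hy ⟨hyY, hyx⟩)
  obtain ⟨u, hu, huY⟩ := exists_seq_forall_of_frequently hfreq
  refine ⟨range u, range_subset_iff.2 fun n => (huY n).1, fun hfin => ?_, fun Z' hZ' hinf hmem => ?_⟩
  · obtain ⟨n, hn⟩ := hfin.isClosed.mem_of_tendsto hu (Eventually.of_forall mem_range_self)
    exact (huY n).2 hn
  · obtain ⟨N, hN⟩ := eventually_atTop.1
      (hu.eventually ((mem_bClosedDiscrete_iff d Z').1 hmem x))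
    refine hinf (((finite_lt_nat N).image u).subset fun z hz => ?_)
    obtain ⟨n, rfl⟩ := hZ' hz
    exact ⟨n, not_le.1 fun hn => hN n hn (huY n).2 hz, rfl⟩

open Classical in
/-- The (ultra)metric in which distinct points `x` and `y` are at distance `max (w x) (w y)`. -/
noncomputable abbrev maxMetricSpace {X : Type*} (w : X → ℝ) (hw : ∀ x, 0 ≤ w x)
    (hinj : ∀ x y, w x = 0 → w y = 0 → x = y) : MetricSpace X where
  dist x y := if x = y then 0 else max (w x) (w y)
  dist_self x := if_pos rfl
  dist_comm x y := by simp only [eq_comm, max_comm]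
  dist_triangle x y z := by
    have := hw x
    have := hw y
    have := hw z
    grind
  eq_of_dist_eq_zero {x y} h := by
    have := hw x
    have := hw y
    have := hinj x y
    grind

open Set Filter Topology in
/-- Any infinite set can be made to accumulate in a metric whose closed discrete sets include
every set with finite trace on it. -/
theorem exists_metricSpace_of_infinite {X : Type*} {Z : Set X} (hZ : Z.Infinite) :
    ∃ d : MetricSpace X, (∀ A, (A ∩ Z).Finite → A ∈ BClosedDiscrete d) ∧
      ∀ Y, Z ⊆ Y → Y ∉ BClosedDiscrete d := by
  let f : ℕ → X := fun n => hZ.natEmbedding Z n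
  have hf : f.Injective := Subtype.val_injective.comp (hZ.natEmbedding Z).injective
  have hfZ (n) : f n ∈ Z := (hZ.natEmbedding Z n).2
  let w : X → ℝ := Function.extend f (fun n => (n : ℝ)⁻¹) 1
  have hwf (n) : w (f n) = (n : ℝ)⁻¹ := hf.extend_apply _ _ n
  have hw' {x} (hx : ¬∃ n, f n = x) : w x = 1 := Function.extend_apply' _ _ x hx
  have hw (x) : 0 ≤ w x := by
    by_cases hx : ∃ n, f n = x
    · obtain ⟨n, rfl⟩ := hx
      simp [hwf]
    · simp [hw' hx]
  have hw0 {x} (hx : w x = 0) : x = f 0 := by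
    by_cases h : ∃ n, f n = x
    · obtain ⟨n, rfl⟩ := h
      simpa [hwf, hf.eq_iff] using hx
    · simp [hw' h] at hx
  let d : MetricSpace X := maxMetricSpace w hw fun x y hx hy => (hw0 hx).trans (hw0 hy).symm
  have hdist {x y : X} (h : x ≠ y) : dist x y = max (w x) (w y) := if_neg h
  refine ⟨d, fun A hA => (mem_bClosedDiscrete_iff d A).2 fun x => ?_, fun Y hY hmem => ?_⟩
  · by_cases hx : x = f 0
    · subst hx
      have hfin : {n | f n ∈ A}.Finite :=
        (hA.preimage hf.injOn).subset fun n hn => ⟨hn, hfZ n⟩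
      obtain ⟨N, hN⟩ := hfin.bddAbove
      refine Metric.eventually_nhds_iff.2 ⟨((N : ℝ) + 1)⁻¹, by positivity, fun y hy hyx hyA => ?_⟩
      rw [hdist hyx] at hy
      have hy := (le_max_left _ _).trans_lt hy
      by_cases h : ∃ n, f n = y
      · obtain ⟨n, rfl⟩ := h
        have hn : 0 < n := Nat.pos_of_ne_zero fun h => hyx (h ▸ rfl)
        have hnN : (n : ℝ) ≤ N := by exact_mod_cast hN hyA
        rw [hwf, inv_lt_inv₀ (by exact_mod_cast hn) (by positivity)] at hy
        linarith
      · rw [hw' h] at hy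
        exact hy.not_ge (inv_le_one_of_one_le₀ (by simp))
    · refine Metric.eventually_nhds_iff.2
        ⟨w x, (hw x).lt_of_ne fun h => hx (hw0 h.symm), fun y hy hyx => ?_⟩
      rw [hdist hyx] at hy
      exact absurd (le_max_right _ _) hy.not_ge
  · have hlim : Tendsto f atTop (𝓝 (f 0)) := by
      refine squeeze_zero' ?_ ?_ tendsto_inv_atTop_nhds_zero_nat |> tendsto_iff_dist_tendsto_zero.2
      · exact Eventually.of_forall fun _ => dist_nonneg
      · filter_upwards [eventually_gt_atTop 0] with n hn
        simp [hdist (hf.ne hn.ne'), hwf]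
    obtain ⟨n, hn, hn0⟩ := ((hlim.eventually ((mem_bClosedDiscrete_iff d Y).1 hmem (f 0))).and
      (eventually_gt_atTop 0)).exists
    exact hn (hf.ne hn0.ne') (hY (hfZ n))

theorem stmt_4 {X : Type*} (B : Set (Set X)) (hB : IsBornology B) :
    (∀ Y : Set X, Y ∉ B → ∃ d : MetricSpace X,
      B ⊆ BClosedDiscrete d ∧ Y ∉ BClosedDiscrete d) ↔ Antitall B := by
  refine ⟨fun h Y hY => ?_, fun h Y hY => ?_⟩
  · obtain ⟨d, hBd, hYd⟩ := h Y hY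
    obtain ⟨Z, hZY, hZ, hZ'⟩ := exists_infinite_subset_of_notMem_bClosedDiscrete d hYd
    exact ⟨Z, hZY, hZ, fun Z' hsub hinf hmem => hZ' Z' hsub hinf (hBd hmem)⟩
  · obtain ⟨Z, hZY, hZ, hZ'⟩ := h Y hY
    obtain ⟨d, hd, hd'⟩ := exists_metricSpace_of_infinite hZ
    exact ⟨d, fun A hA => hd A (Set.not_infinite.1 fun hinf =>
      hZ' _ Set.inter_subset_right hinf (hB.1 A hA _ Set.inter_subset_left)), hd' Y hZY⟩
end

section
/- Let X be an infinite set. A bornology B on X is tall if and only if the set B^ = {p ∈ X* : ∀ A ∈ B, A ∉ p} is nowhere dense in X*, where X* is the space of nonprincipal ultrafilters on X with its subspace topology inherited from the space of all ultrafilters on X. (Proposition 1, first part.) -/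
/-- The hat of a family B: the set of free ultrafilters containing no member of B,
viewed inside the space X* of free (nonprincipal) ultrafilters on X. -/
def hatSet {X : Type*} (B : Set (Set X)) :
    Set {p : Ultrafilter X // ∀ x : X, p ≠ pure x} :=
  {p | ∀ A ∈ B, A ∉ p.1}

theorem Set.Infinite.exists_free_ultrafilter_mem {X : Type*} {Z : Set X} (hZ : Z.Infinite) :
    ∃ p : {p : Ultrafilter X // ∀ x : X, p ≠ pure x}, Z ∈ p.1 := by
  have hne : (Filter.cofinite ⊓ Filter.principal Z).NeBot :=
    Filter.cofinite_inf_principal_neBot_iff.2 hZ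
  obtain ⟨u, hu⟩ := Ultrafilter.exists_le (Filter.cofinite ⊓ Filter.principal Z)
  refine ⟨⟨u, ?_⟩, Filter.le_principal_iff.1 (hu.trans inf_le_right)⟩
  rintro x rfl
  have hx : ({x}ᶜ : Set X) ∈ (pure x : Ultrafilter X) :=
    hu.trans inf_le_left (Set.finite_singleton x).compl_mem_cofinite
  exact Ultrafilter.mem_pure.1 hx rfl

theorem Ultrafilter.infinite_of_mem_of_ne_pure {X : Type*} {p : Ultrafilter X}
    (hp : ∀ x : X, p ≠ pure x) {A : Set X} (hA : A ∈ p) : A.Infinite := by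
  intro hfin
  obtain ⟨x, -, hx⟩ := Ultrafilter.eq_pure_of_finite_mem hfin hA
  exact hp x hx

theorem isClosed_hatSet {X : Type*} (B : Set (Set X)) : IsClosed (hatSet B) := by
  have h : hatSet B = ⋂ A ∈ B, Subtype.val ⁻¹' {u : Ultrafilter X | A ∈ u}ᶜ := by
    ext p
    simp [hatSet]
  rw [h]
  exact isClosed_biInter fun A _ =>
    (ultrafilter_isOpen_basic A).isClosed_compl.preimage continuous_subtype_val

theorem stmt_6 {X : Type*} [Infinite X] (B : Set (Set X)) (hB : IsBornology B) :
    Tall B ↔ IsNowhereDense (hatSet B) := by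
  rw [(isClosed_hatSet B).isNowhereDense_iff]
  constructor
  · intro hT
    refine Set.eq_empty_of_forall_notMem fun p hp => ?_
    rw [mem_interior_iff_mem_nhds, nhds_induced, Filter.mem_comap] at hp
    obtain ⟨U, hU, hUB⟩ := hp
    obtain ⟨_, ⟨A, rfl⟩, hA, hAU⟩ := ultrafilterBasis_is_basis.mem_nhds_iff.1 hU
    obtain ⟨Z, hZA, hZ, hZB⟩ := hT A (Ultrafilter.infinite_of_mem_of_ne_pure p.2 hA)
    obtain ⟨q, hq⟩ := hZ.exists_free_ultrafilter_mem
    have hqB : q ∈ hatSet B := hUB (hAU (Filter.mem_of_superset hq hZA))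
    exact hqB Z hZB hq
  · intro h Y hY
    by_contra! hYB
    obtain ⟨p, hp⟩ := hY.exists_free_ultrafilter_mem
    have hpi : p ∈ interior (hatSet B) := by
      refine mem_interior.2 ⟨Subtype.val ⁻¹' {u : Ultrafilter X | Y ∈ u}, ?_,
        (ultrafilter_isOpen_basic Y).preimage continuous_subtype_val, hp⟩
      intro q hq A hA hAq
      exact hYB (A ∩ Y) Set.inter_subset_right
        (Ultrafilter.infinite_of_mem_of_ne_pure q.2 (Filter.inter_mem hAq hq))
        (hB.1 A hA _ Set.inter_subset_left)
    rw [h] at hpi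
    exact hpi
end

section
/- Every bornology B on a set X is the intersection of a tall bornology and an antitall bornology on X: there exist bornologies B₁ and B₂ on X with B₁ tall, B₂ antitall, and B = B₁ ∩ B₂. (Proposition 1, third part.) -/
theorem IsBornology.union_finite_mem {X : Type*} {B : Set (Set X)} (hB : IsBornology B)
    {b c : Set X} (hb : b ∈ B) (hc : c.Finite) : b ∪ c ∈ B := by
  induction c, hc using Set.Finite.induction_on with
  | empty => simpa using hb
  | @insert a s _ _ ih =>
    have h := hB.2.1 _ ih _ (hB.2.2 a)
    rwa [Set.union_assoc, Set.union_singleton] at h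

theorem Set.Infinite.inter_or_inter_of_subset_union {X : Type*} {Z Y Y' : Set X}
    (hZ : Z.Infinite) (h : Z ⊆ Y ∪ Y') : (Z ∩ Y).Infinite ∨ (Z ∩ Y').Infinite := by
  rw [← Set.infinite_union, ← Set.inter_union_distrib_left, Set.inter_eq_left.2 h]
  exact hZ

/-- The sets without infinite subsets in `B`. -/
def orthogonalFamily {X : Type*} (B : Set (Set X)) : Set (Set X) :=
  {A | ∀ Z ⊆ A, Z.Infinite → Z ∉ B}

/-- The sets that belong to `orthogonalFamily B` after removal of a member of `B`. -/
def tallHull {X : Type*} (B : Set (Set X)) : Set (Set X) :=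
  {A | ∃ b ∈ B, A \ b ∈ orthogonalFamily B}

/-- The sets all of whose infinite subsets contain an infinite member of `B`. -/
def antitallHull {X : Type*} (B : Set (Set X)) : Set (Set X) :=
  {A | ∀ Z ⊆ A, Z.Infinite → ∃ W ⊆ Z, W.Infinite ∧ W ∈ B}

section

variable {X : Type*} {B : Set (Set X)}

theorem subset_tallHull : B ⊆ tallHull B := fun A hA =>
  ⟨A, hA, fun Z hZ hinf => absurd (Set.finite_empty.subset (by simpa using hZ)) hinf⟩

theorem IsBornology.subset_antitallHull (hB : IsBornology B) : B ⊆ antitallHull B :=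
  fun A hA Z hZ hinf => ⟨Z, subset_rfl, hinf, hB.1 A hA Z hZ⟩

theorem IsBornology.tallHull (hB : IsBornology B) : IsBornology (tallHull B) := by
  refine ⟨?_, ?_, fun x => subset_tallHull (hB.2.2 x)⟩
  · rintro A ⟨b, hb, h⟩ A' hA'
    exact ⟨b, hb, fun Z hZ => h Z (hZ.trans (Set.sdiff_subset_sdiff_left hA'))⟩
  · rintro A ⟨b, hb, h⟩ A' ⟨b', hb', h'⟩
    refine ⟨b ∪ b', hB.2.1 b hb b' hb', fun Z hZ hinf hZB => ?_⟩
    have hsub : Z ⊆ (A \ b) ∪ (A' \ b') := fun z hz => by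
      have := hZ hz
      simp only [Set.mem_sdiff, Set.mem_union] at this ⊢
      tauto
    rcases hinf.inter_or_inter_of_subset_union hsub with hi | hi
    · exact h _ Set.inter_subset_right hi (hB.1 Z hZB _ Set.inter_subset_left)
    · exact h' _ Set.inter_subset_right hi (hB.1 Z hZB _ Set.inter_subset_left)

theorem IsBornology.antitallHull (hB : IsBornology B) : IsBornology (antitallHull B) := by
  refine ⟨fun A hA A' hA' Z hZ => hA Z (hZ.trans hA'), ?_,
    fun x => hB.subset_antitallHull (hB.2.2 x)⟩
  intro A hA A' hA' Z hZ hinf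
  rcases hinf.inter_or_inter_of_subset_union hZ with hi | hi
  · obtain ⟨W, hW, hWB⟩ := hA _ Set.inter_subset_right hi
    exact ⟨W, hW.trans Set.inter_subset_left, hWB⟩
  · obtain ⟨W, hW, hWB⟩ := hA' _ Set.inter_subset_right hi
    exact ⟨W, hW.trans Set.inter_subset_left, hWB⟩

theorem IsBornology.tall_tallHull (hB : IsBornology B) : Tall (_root_.tallHull B) := by
  intro Y hY
  by_cases h : Y ∈ orthogonalFamily B
  · obtain ⟨y, -⟩ := hY.nonempty
    exact ⟨Y, subset_rfl, hY, {y}, hB.2.2 y, fun Z hZ => h Z (hZ.trans Set.sdiff_subset)⟩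
  · simp only [orthogonalFamily, Set.mem_ofPred_eq, not_forall, not_not] at h
    obtain ⟨Z, hZ, hinf, hZB⟩ := h
    exact ⟨Z, hZ, hinf, subset_tallHull hZB⟩

theorem antitall_antitallHull : Antitall (antitallHull B) := by
  intro Y hY
  simp only [antitallHull, Set.mem_ofPred_eq, not_forall] at hY
  obtain ⟨Z, hZ, hinf, h⟩ := hY
  refine ⟨Z, hZ, hinf, fun Z' hZ' hinf' hmem => h ?_⟩
  obtain ⟨W, hW, hWB⟩ := hmem Z' subset_rfl hinf'
  exact ⟨W, hW.trans hZ', hWB⟩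

theorem IsBornology.eq_tallHull_inter_antitallHull (hB : IsBornology B) :
    B = _root_.tallHull B ∩ _root_.antitallHull B := by
  refine Set.Subset.antisymm (Set.subset_inter subset_tallHull hB.subset_antitallHull) ?_
  rintro A ⟨⟨b, hb, h⟩, hA⟩
  have hfin : (A \ b).Finite := by
    by_contra hinf
    obtain ⟨W, hW, hWinf, hWB⟩ := hA _ Set.sdiff_subset hinf
    exact h W hW hWinf hWB
  exact hB.1 _ (hB.union_finite_mem hb hfin) A
    (by rw [Set.union_sdiff_self]; exact Set.subset_union_right)

end

theorem stmt_8 {X : Type*} (B : Set (Set X)) (hB : IsBornology B) :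
    ∃ B₁ B₂ : Set (Set X), IsBornology B₁ ∧ IsBornology B₂ ∧
      Tall B₁ ∧ Antitall B₂ ∧ B = B₁ ∩ B₂ :=
  ⟨tallHull B, antitallHull B, hB.tallHull, hB.antitallHull, hB.tall_tallHull,
    antitall_antitallHull, hB.eq_tallHull_inter_antitallHull⟩
end

section
/- Let X be a set and let B be a bornology on X. Then B is antitall if and only if for every Y ⊆ X with Y ∉ B there exists a function f : X → ℕ such that f is bounded on each member of B but f is unbounded on Y. (Proposition 2.) -/
theorem stmt_9 {X : Type*} (B : Set (Set X)) (hB : IsBornology B) :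
    Antitall B ↔
      ∀ Y : Set X, Y ∉ B → ∃ f : X → ℕ,
        (∀ A ∈ B, BddAbove (f '' A)) ∧ ¬ BddAbove (f '' Y) := by
  constructor
  · intro h Y hY
    obtain ⟨Z, hZY, hZ, hZB⟩ := h Y hY
    let e : ℕ → X := fun n => hZ.natEmbedding Z n
    have he : Function.Injective e :=
      Subtype.val_injective.comp (hZ.natEmbedding Z).injective
    have heZ : ∀ n, e n ∈ Z := fun n => (hZ.natEmbedding Z n).2
    refine ⟨Function.extend e id 0, fun A hA => ?_, fun hb => ?_⟩
    · have hfin : (A ∩ Z).Finite := by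
        by_contra hinf
        exact hZB _ Set.inter_subset_right hinf (hB.1 A hA _ Set.inter_subset_left)
      refine (((hfin.image (Function.extend e id 0)).union
        (Set.finite_singleton 0)).subset ?_).bddAbove
      rintro _ ⟨x, hx, rfl⟩
      by_cases hxe : ∃ n, e n = x
      · obtain ⟨n, rfl⟩ := hxe
        exact Or.inl ⟨_, ⟨hx, heZ n⟩, rfl⟩
      · exact Or.inr (by simp [Function.extend_apply' _ _ _ hxe])
    · obtain ⟨M, hM⟩ := hb
      have := hM ⟨e (M + 1), hZY (heZ _), he.extend_apply id 0 (M + 1)⟩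
      simp at this
  · intro h Y hY
    obtain ⟨f, hf, hfY⟩ := h Y hY
    have hinf : (f '' Y).Infinite := fun hfin => hfY hfin.bddAbove
    obtain ⟨Z, hZY, hZ⟩ := (Set.surjOn_image f Y).exists_bijOn_subset
    refine ⟨Z, hZY, fun hfin => hinf (hZ.image_eq ▸ hfin.image f), fun Z' hZ' hZ'inf hZ'B => ?_⟩
    exact hZ'inf.image (hZ.injOn.mono hZ') (hf Z' hZ'B).finite
end

section
/- Let X be a set and let I be an ideal on X (a family of subsets of X closed under taking subsets and finite unions). Then I^¬ = {A ⊆ X : no infinite subset of A belongs to I} is an antitall bornology on X. (Proposition 3, first part.) -/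
def IsIdeal {X : Type*} (I : Set (Set X)) : Prop :=
  (∀ A ∈ I, ∀ A' ⊆ A, A' ∈ I) ∧ (∀ A ∈ I, ∀ A' ∈ I, A ∪ A' ∈ I)

/-- For a family F of subsets of X, F^¬ is the family of all subsets of X
none of whose infinite subsets belongs to F. -/
def negOp {X : Type*} (F : Set (Set X)) : Set (Set X) :=
  {A : Set X | ∀ Z ⊆ A, Z.Infinite → Z ∉ F}

theorem stmt_10 {X : Type*} (I : Set (Set X)) (hI : IsIdeal I) :
    IsBornology (negOp I) ∧ Antitall (negOp I) := by
  obtain ⟨hsub, -⟩ := hI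
  refine ⟨⟨fun A hA A' h Z hZ => hA Z (hZ.trans h), fun A hA A' hA' Z hZ hinf hZI => ?_,
    fun x Z hZ hinf => absurd ((Set.finite_singleton x).subset hZ) hinf⟩, fun Y hY => ?_⟩
  · have hcover : Z = Z ∩ A ∪ Z ∩ A' := by
      rw [← Set.inter_union_distrib_left, Set.inter_eq_left.2 hZ]
    rw [hcover, Set.infinite_union] at hinf
    rcases hinf with h | h
    · exact hA _ Set.inter_subset_right h (hsub Z hZI _ Set.inter_subset_left)
    · exact hA' _ Set.inter_subset_right h (hsub Z hZI _ Set.inter_subset_left)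
  · simp only [negOp, Set.mem_ofPred_eq, not_forall, not_not] at hY
    obtain ⟨Z, hZY, hinf, hZI⟩ := hY
    exact ⟨Z, hZY, hinf, fun Z' hZ' hinf' hmem =>
      hmem Z' subset_rfl hinf' (hsub Z hZI Z' hZ')⟩
end

section
/- Let X be a set, let I be a bornology on X, and let τ_I be the topology on the power set P(X) of uniform convergence on members of I, i.e., the topology in which for each Y ⊆ X the sets {Z ⊆ X : Z ∩ A = Y ∩ A}, A ∈ I, form a neighbourhood base at Y. Identify X with the subspace {{x} : x ∈ X} of (P(X), τ_I). Then the following are equivalent: (i) every infinite subset Y ⊆ X has an infinite subset that is closed and discrete in (P(X), τ_I) (under the identification of points of X with singletons); (ii) the set of finite subsets of X is a closed subset of (P(X), τ_I); (iii) I is tall. (Proposition 4.) -/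
/-- The topology on P(X) of uniform convergence on members of I: generated by the sets
{Z | Z ∩ A = Y ∩ A} for Y ⊆ X and A ∈ I, which form the neighbourhood base at Y. -/
def tauI {X : Type*} (I : Set (Set X)) : TopologicalSpace (Set X) :=
  TopologicalSpace.generateFrom
    {U : Set (Set X) | ∃ (Y A : Set X), A ∈ I ∧ U = {Z : Set X | Z ∩ A = Y ∩ A}}

open scoped Topology

theorem isOpen_tauI_iff {X : Type*} {I : Set (Set X)} (hI : IsBornology I) (U : Set (Set X)) :
    IsOpen[tauI I] U ↔
      ∀ Y ∈ U, ∃ A, (A ∈ I ∨ A = ∅) ∧ ∀ Z : Set X, Z ∩ A = Y ∩ A → Z ∈ U := by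
  constructor
  · intro h
    change TopologicalSpace.GenerateOpen _ U at h
    induction h with
    | basic s hs =>
      obtain ⟨W, A, hA, rfl⟩ := hs
      exact fun Y hY => ⟨A, Or.inl hA, fun Z hZ => hZ.trans hY⟩
    | univ => exact fun Y _ => ⟨∅, Or.inr rfl, fun _ _ => trivial⟩
    | inter s t _ _ ihs iht =>
      intro Y hY
      obtain ⟨A, hA, hAs⟩ := ihs Y hY.1
      obtain ⟨B, hB, hBt⟩ := iht Y hY.2
      refine ⟨A ∪ B, ?_, fun Z hZ => ⟨hAs Z ?_, hBt Z ?_⟩⟩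
      · rcases hA with hA | rfl
        · rcases hB with hB | rfl
          · exact Or.inl (hI.2.1 A hA B hB)
          · simpa using Or.inl hA
        · simpa using hB
      · simpa [Set.inter_assoc, Set.union_inter_cancel_left] using congrArg (· ∩ A) hZ
      · simpa [Set.inter_assoc, Set.union_inter_cancel_right] using congrArg (· ∩ B) hZ
    | sUnion S _ ih =>
      rintro Y ⟨s, hs, hY⟩
      obtain ⟨A, hA, h⟩ := ih s hs Y hY
      exact ⟨A, hA, fun Z hZ => ⟨s, hs, h Z hZ⟩⟩
  · intro h
    let _ : TopologicalSpace (Set X) := tauI I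
    rw [isOpen_iff_forall_mem_open]
    intro Y hY
    obtain ⟨A, hA | rfl, hAU⟩ := h Y hY
    · exact ⟨{Z | Z ∩ A = Y ∩ A}, hAU, TopologicalSpace.isOpen_generateFrom_of_mem
        ⟨Y, A, hA, rfl⟩, rfl⟩
    · exact ⟨Set.univ, fun Z _ => hAU Z (by simp), isOpen_univ, trivial⟩

theorem isClosed_tauI_iff {X : Type*} {I : Set (Set X)} (hI : IsBornology I) (C : Set (Set X)) :
    IsClosed[tauI I] C ↔
      ∀ Y ∉ C, ∃ A, (A ∈ I ∨ A = ∅) ∧ ∀ Z : Set X, Z ∩ A = Y ∩ A → Z ∉ C := by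
  let _ : TopologicalSpace (Set X) := tauI I
  rw [← isOpen_compl_iff]
  exact isOpen_tauI_iff hI Cᶜ

theorem isClosed_tauI_singletons_iff {X : Type*} {I : Set (Set X)} (hI : IsBornology I)
    {Z : Set X} (hZ : Z.Nonempty) :
    IsClosed[tauI I] ((fun x => ({x} : Set X)) '' Z) ↔ Z ∈ I := by
  rw [isClosed_tauI_iff hI]
  constructor
  · intro h
    obtain ⟨A, hA, hAZ⟩ := h ∅ (by simp)
    have hsub : Z ⊆ A := by
      intro z hz
      by_contra hzA
      exact hAZ {z} (by simpa using hzA) ⟨z, hz, rfl⟩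
    rcases hA with hA | rfl
    · exact hI.1 A hA Z hsub
    · exact absurd hZ (by simp [Set.subset_empty_iff.1 hsub])
  · intro h S hS
    by_cases hSZ : S ∩ Z = ∅
    · refine ⟨Z, Or.inl h, ?_⟩
      rintro _ hW ⟨w, hw, rfl⟩
      rw [hSZ] at hW
      exact Set.notMem_empty w (hW ▸ ⟨rfl, hw⟩)
    · obtain ⟨z, hzS, hzZ⟩ := Set.nonempty_iff_ne_empty.2 hSZ
      obtain ⟨y, hyS, hyz⟩ : ∃ y ∈ S, y ≠ z := by
        by_contra! hall
        exact hS ⟨z, hzZ, by ext y; exact ⟨fun hy => by rwa [Set.mem_singleton_iff.1 hy], hall y⟩⟩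
      refine ⟨{z} ∪ {y}, Or.inl (hI.2.1 _ (hI.2.2 z) _ (hI.2.2 y)), ?_⟩
      rintro _ hW ⟨w, -, rfl⟩
      have hz : z ∈ ({w} : Set X) := ((Set.ext_iff.1 hW z).2 ⟨hzS, Or.inl rfl⟩).1
      have hy : y ∈ ({w} : Set X) := ((Set.ext_iff.1 hW y).2 ⟨hyS, Or.inr rfl⟩).1
      exact hyz (hy.trans hz.symm)

theorem discreteTopology_tauI_singletons {X : Type*} {I : Set (Set X)} (hI : IsBornology I)
    (Z : Set X) :
    letI : TopologicalSpace (Set X) := tauI I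
    DiscreteTopology ((fun x => ({x} : Set X)) '' Z) := by
  let _ : TopologicalSpace (Set X) := tauI I
  refine discreteTopology_iff_isOpen_singleton.2 ?_
  rintro ⟨_, z, hz, rfl⟩
  refine ⟨{W | W ∩ {z} = {z} ∩ {z}}, TopologicalSpace.isOpen_generateFrom_of_mem
    ⟨{z}, {z}, hI.2.2 z, rfl⟩, ?_⟩
  ext ⟨_, w, hw, rfl⟩
  simp [Subtype.ext_iff, eq_comm]

theorem isClosed_tauI_finite_iff {X : Type*} {I : Set (Set X)} (hI : IsBornology I) :
    IsClosed[tauI I] {A : Set X | A.Finite} ↔ Tall I := by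
  rw [isClosed_tauI_iff hI]
  constructor
  · intro h Y hY
    obtain ⟨A, hA, hAY⟩ := h Y hY
    have hinf : (Y ∩ A).Infinite := hAY (Y ∩ A) (by rw [Set.inter_assoc, Set.inter_self])
    rcases hA with hA | rfl
    · exact ⟨Y ∩ A, Set.inter_subset_left, hinf, hI.1 A hA _ Set.inter_subset_right⟩
    · simp at hinf
  · intro h Y hY
    obtain ⟨Z, hZY, hZ, hZI⟩ := h Y hY
    refine ⟨Z, Or.inl hZI, fun W hW hWfin => hZ ?_⟩
    rw [Set.inter_eq_right.2 hZY] at hW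
    exact Set.Finite.subset hWfin (Set.inter_eq_right.1 hW)

theorem stmt_13 {X : Type*} (I : Set (Set X)) (hI : IsBornology I) :
    letI : TopologicalSpace (Set X) := tauI I
    ((∀ Y : Set X, Y.Infinite → ∃ Z ⊆ Y, Z.Infinite ∧
        IsClosed ((fun x => ({x} : Set X)) '' Z) ∧
        DiscreteTopology ((fun x => ({x} : Set X)) '' Z)) ↔ Tall I) ∧
      (IsClosed {A : Set X | A.Finite} ↔ Tall I) := by
  refine ⟨forall₂_congr fun Y _ => exists_congr fun Z => and_congr_right fun _ =>
    and_congr_right fun hZ => ?_, isClosed_tauI_finite_iff hI⟩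
  rw [isClosed_tauI_singletons_iff hI hZ.nonempty]
  exact and_iff_left (discreteTopology_tauI_singletons hI Z)
end

section
/- Let (X, B) be a bornological space with B antitall. Then the hyperbornology exp B on the set B is antitall: every family A of bounded subsets of X that is unbounded in exp B (i.e., there is no A ∈ B containing every member of A) contains an infinite subfamily none of whose infinite subfamilies is bounded in exp B. (Section 5, item 2.) -/
/-- The hyperbornology on the set B: a family of bounded sets is bounded
iff it has a common bound in B. -/
def expBorn {X : Type*} (B : Set (Set X)) : Set (Set B) :=
  {𝒜 : Set B | ∃ A ∈ B, ∀ Y ∈ 𝒜, (Y : Set X) ⊆ A}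

theorem stmt_15 {X : Type*} (B : Set (Set X)) (hB : IsBornology B) (hA : Antitall B) :
    Antitall (expBorn B) := by
  intro 𝒜 h𝒜
  have hU : (⋃ Y ∈ 𝒜, (Y : Set X)) ∉ B := fun h =>
    h𝒜 ⟨_, h, fun Y hY => Set.subset_biUnion_of_mem (u := fun Y : B => (Y : Set X)) hY⟩
  obtain ⟨Z, hZU, hZ, hZB⟩ := hA _ hU
  have hfin : ∀ A ∈ B, (Z ∩ A).Finite := fun A hAB => by
    by_contra h
    exact hZB _ Set.inter_subset_left h (hB.1 A hAB _ Set.inter_subset_right)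
  have hmem : ∀ z : Z, ∃ Y ∈ 𝒜, (z : X) ∈ (Y : Set X) := fun z => by
    simpa only [Set.mem_iUnion, exists_prop] using hZU z.2
  choose f hf𝒜 hf using hmem
  refine ⟨Set.range f, Set.range_subset_iff.2 hf𝒜, fun hr => hZ ?_, ?_⟩
  · refine (hr.biUnion fun Y _ => hfin Y Y.2).subset fun z hz => ?_
    exact Set.mem_biUnion (Set.mem_range_self ⟨z, hz⟩) ⟨hz, hf ⟨z, hz⟩⟩
  · rintro 𝒵 h𝒵 hinf ⟨A, hAB, hbound⟩
    have hpre : (f ⁻¹' 𝒵).Finite :=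
      Set.Finite.of_finite_image ((hfin A hAB).subset (by
        rintro _ ⟨z, hz, rfl⟩
        exact ⟨z.2, hbound _ hz (hf z)⟩)) Subtype.val_injective.injOn
    exact hinf (Set.image_preimage_eq_of_subset h𝒵 ▸ hpre.image f)
end

section
/- Let X be a countably infinite set and let B be a bornology on X with B ≠ P(X). Then the hyperbornology exp B on the set B is not tall. (Section 5, item 2.) -/
theorem IsBornology.finite_mem {X : Type*} [Nonempty X] {B : Set (Set X)} (hB : IsBornology B)
    {A : Set X} (hA : A.Finite) : A ∈ B := by
  induction A, hA using Set.Finite.induction_on with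
  | empty => exact hB.1 _ (hB.2.2 (Classical.arbitrary X)) _ (Set.empty_subset _)
  | @insert a s _ _ ih => exact hB.2.1 _ (hB.2.2 a) _ ih

theorem IsBornology.univ_notMem {X : Type*} {B : Set (Set X)} (hB : IsBornology B)
    (hne : B ≠ Set.univ) : Set.univ ∉ B :=
  fun h => hne (Set.eq_univ_of_forall fun A => hB.1 _ h A (Set.subset_univ A))

theorem stmt_16 {X : Type*} [Countable X] [Infinite X]
    (B : Set (Set X)) (hB : IsBornology B) (hne : B ≠ Set.univ) :
    ¬ Tall (expBorn B) := by
  obtain ⟨e⟩ : Nonempty (ℕ ≃ X) := nonempty_equiv_of_countable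
  -- The initial segments of an enumeration: any infinitely many of them cover `X`.
  let F : ℕ → B := fun n => ⟨e '' Set.Iio n, hB.finite_mem ((Set.finite_Iio n).image e)⟩
  have hF : Function.Injective F := fun m n h =>
    Set.Iio_injective (e.injective.image_injective (congrArg Subtype.val h))
  intro hT
  obtain ⟨Z, hZF, hZ, A, hA, hZA⟩ := hT (Set.range F) (Set.infinite_range_of_injective hF)
  refine hB.univ_notMem hne (hB.1 A hA _ fun x _ => ?_)
  obtain ⟨n, hn, hxn⟩ := (hZ.preimage hZF).exists_gt (e.symm x)
  exact hZA (F n) hn ⟨e.symm x, hxn, e.apply_symm_apply x⟩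
end
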